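/- Let n ≥ 1, δ ∈ ℝ, V ⊆ {−1,1}ⁿ, and β > 0 be such that d(v,v′) ≥ β for all distinct v, v′ ∈ V, where d(v,v′) := min over unit vectors φ ∈ ℂ^{2ⁿ} of (⟨φ, H_v^δ φ⟩ + n) + (⟨φ, H_{v′}^δ φ⟩ + n). Let (Ω, P) be a probability space and ψ : Ω → ℂ^{2ⁿ} a measurable map with ‖ψ(ω)‖ = 1 almost surely. If some v ∈ V satisfies E[⟨ψ, H_v^δ ψ⟩] + n ≤ β/9, then with probability at least 2/3, ⟨ψ, H_v^δ ψ⟩ < ⟨ψ, H_{v′}^δ ψ⟩ for every v′ ∈ V with v′ ≠ v; i.e., v is the unique minimizer over V of v′ ↦ ⟨ψ, H_{v′}^δ ψ⟩. -/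

import Mathlib

open Matrix Real Finset

/-- Single-site Pauli X on qubit `i` of an `n`-qubit system. -/
noncomputable def pauliX (n : ℕ) (i : Fin n) : Matrix (Fin n → Fin 2) (Fin n → Fin 2) ℂ :=
  fun f g => if f i ≠ g i ∧ ∀ j, j ≠ i → f j = g j then 1 else 0

/-- Single-site Pauli Z on qubit `i` of an `n`-qubit system. -/
noncomputable def pauliZ (n : ℕ) (i : Fin n) : Matrix (Fin n → Fin 2) (Fin n → Fin 2) ℂ :=
  fun f g => if f = g then (-1 : ℂ) ^ ((f i : ℕ)) else 0

/-- The objective observable `H_v^δ = -∑ᵢ [sin(π/4 + vᵢ δ) Xᵢ + cos(π/4 + vᵢ δ) Zᵢ]`. -/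
noncomputable def Ham (n : ℕ) (δ : ℝ) (v : Fin n → ℝ) :
    Matrix (Fin n → Fin 2) (Fin n → Fin 2) ℂ :=
  - ∑ i : Fin n, (((Real.sin (π/4 + v i * δ) : ℝ) : ℂ) • pauliX n i
      + ((Real.cos (π/4 + v i * δ) : ℝ) : ℂ) • pauliZ n i)

/-- The quadratic form `⟨ψ, M ψ⟩`, conjugate-linear in the first argument. -/
noncomputable def qform {m : Type*} [Fintype m] (M : Matrix m m ℂ) (ψ : m → ℂ) : ℂ :=
  star ψ ⬝ᵥ M.mulVec ψ
open MeasureTheory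
open scoped ENNReal

/-- Flipping the `i`-th bit of a bit string. -/
def flipBit {n : ℕ} (i : Fin n) (f : Fin n → Fin 2) : Fin n → Fin 2 :=
  Function.update f i (f i + 1)

theorem flipBit_involutive {n : ℕ} (i : Fin n) : Function.Involutive (flipBit i) := by
  intro f
  have h : ∀ b : Fin 2, b + 1 + 1 = b := by decide
  simp [flipBit, h]

theorem flipBit_eq_iff {n : ℕ} (i : Fin n) (f g : Fin n → Fin 2) :
    (f i ≠ g i ∧ ∀ j, j ≠ i → f j = g j) ↔ flipBit i f = g := by
  have h : ∀ a b : Fin 2, a ≠ b ↔ a + 1 = b := by decide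
  rw [flipBit, Function.update_eq_iff, h]

theorem pauliX_mulVec (n : ℕ) (i : Fin n) (φ : (Fin n → Fin 2) → ℂ) (f : Fin n → Fin 2) :
    (pauliX n i).mulVec φ f = φ (flipBit i f) := by
  simp [Matrix.mulVec, dotProduct, pauliX, flipBit_eq_iff]

theorem pauliZ_mulVec (n : ℕ) (i : Fin n) (φ : (Fin n → Fin 2) → ℂ) (f : Fin n → Fin 2) :
    (pauliZ n i).mulVec φ f = (-1 : ℂ) ^ ((f i : ℕ)) * φ f := by
  simp [Matrix.mulVec, dotProduct, pauliZ]

theorem two_mul_mul_le_of_sq_add_sq {s c : ℝ} (h : s ^ 2 + c ^ 2 = 1) (x u : ℝ) :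
    2 * (s * (x * u)) + c * (x ^ 2 - u ^ 2) ≤ x ^ 2 + u ^ 2 := by
  have hs : s ^ 2 = 1 - c ^ 2 := by linarith
  have key : 2 * (x ^ 2 + u ^ 2 - (2 * (s * (x * u)) + c * (x ^ 2 - u ^ 2))) =
      ((1 - c) * x - s * u) ^ 2 + ((1 + c) * u - s * x) ^ 2 := by
    linear_combination (-(u ^ 2 + x ^ 2)) * hs
  nlinarith [sq_nonneg ((1 - c) * x - s * u), sq_nonneg ((1 + c) * u - s * x)]

theorem re_dotProduct_star_self {m : Type*} [Fintype m] (φ : m → ℂ) :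
    (star φ ⬝ᵥ φ).re = ∑ f, Complex.normSq (φ f) := by
  simp [dotProduct, Complex.normSq_apply]

theorem qform_site_re_le (n : ℕ) (i : Fin n) {s c : ℝ} (h : s ^ 2 + c ^ 2 = 1)
    (φ : (Fin n → Fin 2) → ℂ) :
    (qform ((s : ℂ) • pauliX n i + (c : ℂ) • pauliZ n i) φ).re ≤ (star φ ⬝ᵥ φ).re := by
  set F : (Fin n → Fin 2) → ℝ := fun f =>
    s * ((φ f).re * (φ (flipBit i f)).re + (φ f).im * (φ (flipBit i f)).im)
      + c * (-1) ^ ((f i : ℕ)) * Complex.normSq (φ f) with hF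
  have hflip (G : (Fin n → Fin 2) → ℝ) : ∑ f, G (flipBit i f) = ∑ f, G f :=
    (flipBit_involutive i).bijective.sum_comp G
  have hq : (qform ((s : ℂ) • pauliX n i + (c : ℂ) • pauliZ n i) φ).re = ∑ f, F f := by
    simp only [qform, dotProduct, Matrix.add_mulVec, Matrix.smul_mulVec, Pi.add_apply,
      Pi.smul_apply, pauliX_mulVec, pauliZ_mulVec, Complex.re_sum]
    refine Finset.sum_congr rfl fun f _ => ?_
    rcases Nat.even_or_odd (f i : ℕ) with hp | hp <;>
      simp [hF, hp.neg_one_pow, Complex.normSq_apply] <;> ring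
  have hpair (f : Fin n → Fin 2) : F f + F (flipBit i f) ≤
      Complex.normSq (φ f) + Complex.normSq (φ (flipBit i f)) := by
    have hsign : ∀ b : Fin 2, (-1 : ℝ) ^ ((b + 1 : Fin 2) : ℕ) = -(-1) ^ (b : ℕ) := by
      intro b; fin_cases b <;> simp
    have hσ : s ^ 2 + (c * (-1) ^ ((f i : ℕ))) ^ 2 = 1 := by
      rw [mul_pow, ← pow_mul, mul_comm _ 2, pow_mul]; simpa using h
    have hfi : flipBit i f i = f i + 1 := by simp [flipBit]
    simp only [hF, flipBit_involutive i f, hfi, hsign, Complex.normSq_apply]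
    linarith [two_mul_mul_le_of_sq_add_sq hσ (φ f).re (φ (flipBit i f)).re,
      two_mul_mul_le_of_sq_add_sq hσ (φ f).im (φ (flipBit i f)).im]
  have hsum := Finset.sum_le_sum fun f (_ : f ∈ Finset.univ) => hpair f
  clear_value F
  rw [Finset.sum_add_distrib, Finset.sum_add_distrib, hflip F,
    hflip fun f => Complex.normSq (φ f)] at hsum
  rw [hq, re_dotProduct_star_self]
  linarith

theorem qform_Ham (n : ℕ) (δ : ℝ) (v : Fin n → ℝ) (φ : (Fin n → Fin 2) → ℂ) :
    qform (Ham n δ v) φ = -∑ i, qform (((Real.sin (π/4 + v i * δ) : ℝ) : ℂ) • pauliX n i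
      + ((Real.cos (π/4 + v i * δ) : ℝ) : ℂ) • pauliZ n i) φ := by
  simp only [qform, Ham, Matrix.neg_mulVec, Matrix.sum_mulVec, dotProduct_neg, dotProduct_sum]

theorem qform_Ham_re_add_nonneg (n : ℕ) (δ : ℝ) (v : Fin n → ℝ) {φ : (Fin n → Fin 2) → ℂ}
    (hφ : star φ ⬝ᵥ φ = 1) : 0 ≤ (qform (Ham n δ v) φ).re + n := by
  have h := Finset.sum_le_sum fun i (_ : i ∈ (Finset.univ : Finset (Fin n))) =>
    qform_site_re_le n i (Real.sin_sq_add_cos_sq (π/4 + v i * δ)) φ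
  rw [qform_Ham, Complex.neg_re, Complex.re_sum]
  simp only [hφ, Complex.one_re, Finset.sum_const, Finset.card_univ, Fintype.card_fin,
    nsmul_eq_mul, mul_one] at h
  linarith

theorem continuous_qform_re {m : Type*} [Fintype m] (M : Matrix m m ℂ) :
    Continuous fun φ => (qform M φ).re := by
  unfold qform
  fun_prop

theorem star_dotProduct_self_of_norm_eq_one {m : Type*} [Fintype m] {φ : m → ℂ}
    (h : ‖(EuclideanSpace.equiv m ℂ).symm φ‖ = 1) : star φ ⬝ᵥ φ = 1 := by
  have h2 := EuclideanSpace.inner_eq_star_dotProduct ((EuclideanSpace.equiv m ℂ).symm φ)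
    ((EuclideanSpace.equiv m ℂ).symm φ)
  rw [inner_self_eq_norm_sq_to_K, h] at h2
  rw [dotProduct_comm]
  simpa using h2.symm

theorem exists_abs_qform_re_le {m : Type*} [Fintype m] (M : Matrix m m ℂ) :
    ∃ C, ∀ φ : m → ℂ, ‖(EuclideanSpace.equiv m ℂ).symm φ‖ = 1 → ‖(qform M φ).re‖ ≤ C := by
  obtain ⟨C, hC⟩ := (isCompact_sphere (0 : EuclideanSpace ℂ m) 1).exists_bound_of_continuousOn
    (((continuous_qform_re M).comp (EuclideanSpace.equiv m ℂ).continuous).continuousOn)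
  exact ⟨C, fun φ hφ =>
    hC ((EuclideanSpace.equiv m ℂ).symm φ) (mem_sphere_zero_iff_norm.2 hφ)⟩

/-- If the family `{H_v^δ : v ∈ V}` is `β`-separated in the semimetric `d`, `ψ` is a random
unit vector, and for some `v ∈ V` the expected energy satisfies `E[⟨ψ,H_v^δψ⟩] + n ≤ β/9`,
then with probability at least `2/3` the parameter `v` is the unique minimizer over `V` of
`v' ↦ ⟨ψ, H_{v'}^δ ψ⟩`. -/
theorem estimator_from_optimizer (n : ℕ) (hn : 1 ≤ n) (δ : ℝ) (V : Finset (Fin n → ℝ))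
    (hV : ∀ v ∈ V, ∀ i, v i = 1 ∨ v i = -1) (β : ℝ) (hβ : 0 < β)
    (hsep : ∀ v ∈ V, ∀ v' ∈ V, v ≠ v' →
      ∀ φ : (Fin n → Fin 2) → ℂ, star φ ⬝ᵥ φ = 1 →
        β ≤ ((qform (Ham n δ v) φ).re + n) + ((qform (Ham n δ v') φ).re + n))
    {Ω : Type*} [MeasurableSpace Ω] (P : Measure Ω) [IsProbabilityMeasure P]
    (ψ : Ω → (Fin n → Fin 2) → ℂ) (hmeas : Measurable ψ)
    (hunit : ∀ᵐ ω ∂P, ‖(EuclideanSpace.equiv (Fin n → Fin 2) ℂ).symm (ψ ω)‖ = 1)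
    (v : Fin n → ℝ) (hv : v ∈ V)
    (hopt : (∫ ω, (qform (Ham n δ v) (ψ ω)).re ∂P) + n ≤ β / 9) :
    (2 / 3 : ℝ≥0∞) ≤ P {ω | ∀ v' ∈ V, v' ≠ v →
      (qform (Ham n δ v) (ψ ω)).re < (qform (Ham n δ v') (ψ ω)).re} := by
  obtain ⟨C, hC⟩ := exists_abs_qform_re_le (Ham n δ v)
  have hcont : Measurable fun ω => (qform (Ham n δ v) (ψ ω)).re :=
    (continuous_qform_re _).measurable.comp hmeas
  have hint : Integrable (fun ω => (qform (Ham n δ v) (ψ ω)).re) P :=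
    Integrable.of_bound hcont.aestronglyMeasurable C (hunit.mono fun ω hω => hC _ hω)
  set E : Ω → ℝ := fun ω => (qform (Ham n δ v) (ψ ω)).re + n with hE
  have hEmeas : Measurable E := hcont.add_const _
  have hEint : ∫ ω, E ω ∂P ≤ β / 9 := by
    simpa [hE, integral_add hint (integrable_const _)] using hopt
  have hmarkov := mul_meas_ge_le_integral_of_nonneg
    (hunit.mono fun ω hω => qform_Ham_re_add_nonneg n δ v (star_dotProduct_self_of_norm_eq_one hω))
    (hint.add (integrable_const (n : ℝ))) (β / 3)
  have hbad : P.real {ω | β / 3 ≤ E ω} ≤ 1 / 3 := by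
    have h : β / 3 * P.real {ω | β / 3 ≤ E ω} ≤ β / 9 := hmarkov.trans hEint
    nlinarith
  have hgood : 2 / 3 ≤ P.real {ω | β / 3 ≤ E ω}ᶜ := by
    rw [probReal_compl_eq_one_sub (measurableSet_le measurable_const hEmeas)]
    linarith
  calc (2 / 3 : ℝ≥0∞) = ENNReal.ofReal (2 / 3) := by
        rw [ENNReal.ofReal_div_of_pos (by norm_num)]; norm_num
    _ ≤ P {ω | β / 3 ≤ E ω}ᶜ := (ENNReal.ofReal_le_iff_le_toReal (measure_ne_top _ _)).2 hgood
    _ ≤ _ := measure_mono_ae <| hunit.mono fun ω hω hlt v' hv' hne => by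
        have hlow : E ω < β / 3 := not_le.1 hlt
        have := hsep v hv v' hv' hne.symm (ψ ω) (star_dotProduct_self_of_norm_eq_one hω)
        simp only [hE] at hlow
        linarith
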